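/- Let k be a field of characteristic zero, R = k[x_1,…,x_n], and let p be a prime ideal of R of height c such that {x_{c+1},…,x_n} is a basis modulo p. Let K ⊆ R^r be a submodule, M = R^r/K with projection π : R^r → M, and let U ⊆ M be a p-primary R-submodule of multiplicity m over p. Then the lift Ũ := π^{-1}(U) ⊆ R^r is a p-primary R-submodule of R^r of multiplicity m over p, and there exist m differential operators δ_1,…,δ_m ∈ D_{n,c}^r such that Ũ = {w ∈ R^r | δ_i(w) ∈ p for all 1 ≤ i ≤ m}. -/

import Mathlib

set_option maxHeartbeats 1000000
set_option synthInstance.maxHeartbeats 400000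

open MvPolynomial

section DiffOps

variable {n : ℕ} {k : Type*} [CommSemiring k]

/-- The iterated partial derivative `∂^α = ∂^{|α|}/∂x_1^{α_1}⋯∂x_n^{α_n}` on
`R = k[x_1,…,x_n]`, as a `k`-linear endomorphism. -/
noncomputable def derivOp (α : Fin n →₀ ℕ) : Module.End k (MvPolynomial (Fin n) k) :=
  (List.ofFn fun i : Fin n =>
    ((MvPolynomial.pderiv i).toLinearMap : Module.End k (MvPolynomial (Fin n) k)) ^ (α i)).prod

/-- A differential operator `δ ∈ D_n^r`, encoded by a finitely supported family
`(c_{j,α})` of polynomials. -/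
abbrev DiffOp (n : ℕ) (k : Type*) [CommSemiring k] (r : ℕ) :=
  Fin r → ((Fin n →₀ ℕ) →₀ MvPolynomial (Fin n) k)

/-- The `k`-linear action of `δ ∈ D_n^r` on `R^r`: `δ(w) = Σ_{j,α} c_{j,α}·∂^α w_j`. -/
noncomputable def DiffOp.act {r : ℕ} (δ : DiffOp n k r) :
    (Fin r → MvPolynomial (Fin n) k) →ₗ[k] MvPolynomial (Fin n) k :=
  ∑ j : Fin r, (δ j).sum fun α cα =>
    cα • ((derivOp α).comp
      (LinearMap.proj j : (Fin r → MvPolynomial (Fin n) k) →ₗ[k] MvPolynomial (Fin n) k))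

/-- `δ` lies in `D_{n,c}^r`, i.e. involves only `∂_{x_1},…,∂_{x_c}`:
`c_{j,α} = 0` whenever `α_i ≠ 0` for some `i > c`. -/
def DiffOp.InRelWeyl {r : ℕ} (c : ℕ) (δ : DiffOp n k r) : Prop :=
  ∀ j : Fin r, ∀ α ∈ (δ j).support, ∀ i : Fin n, c ≤ (i : ℕ) → α i = 0

end DiffOps

section Mult

variable {R : Type*} [CommRing R]

/-- The multiplicity of a submodule `U ⊆ M` over a prime `p`: the length of the
`R_p`-module `M_p/U_p ≅ (M/U)_p`, expressed as the Krull dimension of the lattice of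
`R_p`-submodules. -/
noncomputable def multOver (p : Ideal R) [p.IsPrime] {M : Type*} [AddCommGroup M]
    [Module R M] (U : Submodule R M) : WithBot ℕ∞ :=
  Order.krullDim (Submodule (Localization.AtPrime p) (LocalizedModule p.primeCompl (M ⧸ U)))

/-- `U ⊆ M` is a `p`-primary submodule: `Ass_R(M/U) = {p}`. -/
def IsPrimarySubmodule (p : Ideal R) {M : Type*} [AddCommGroup M] [Module R M]
    (U : Submodule R M) : Prop :=
  associatedPrimes R (M ⧸ U) = {p}

end Mult

section Taylor

variable {n : ℕ} {k : Type*} [Field k] [CharZero k]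

lemma monomial_congr' {α β : Fin n →₀ ℕ} {a b : k} (h : ∀ i, α i = β i) (h' : a = b) :
    (monomial α a : MvPolynomial (Fin n) k) = monomial β b := by
  rw [Finsupp.ext h, h']

lemma pderiv_pow_monomial (i : Fin n) (a : ℕ) (β : Fin n →₀ ℕ) (b : k) :
    (((MvPolynomial.pderiv i).toLinearMap : Module.End k (MvPolynomial (Fin n) k)) ^ a)
      (monomial β b) = monomial (β - Finsupp.single i a) (b * ((β i).descFactorial a : k)) := by
  induction a with
  | zero => simp
  | succ a ih =>
    rw [pow_succ', Module.End.mul_apply, ih]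
    simp only [Derivation.coeFn_coe, pderiv_monomial]
    refine monomial_congr' (fun j => ?_) ?_
    · skip
      by_cases h : i = j
      · subst h; simp; omega
      · simp [Finsupp.single_apply, h]
    · simp only [Finsupp.coe_tsub, Pi.sub_apply, Finsupp.single_eq_same, Nat.descFactorial_succ]
      push_cast
      ring

lemma list_deriv_monomial (α : Fin n →₀ ℕ) (l : List (Fin n)) (hl : l.Nodup)
    (β : Fin n →₀ ℕ) (b : k) :
    (l.map fun i => ((MvPolynomial.pderiv i).toLinearMap :
      Module.End k (MvPolynomial (Fin n) k)) ^ (α i)).prod (monomial β b) =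
    monomial (β - α.filter (· ∈ l)) (b * (l.map fun i => ((β i).descFactorial (α i) : k)).prod) := by
  induction l with
  | nil =>
    rw [List.map_nil, List.prod_nil, Module.End.one_apply]
    refine monomial_congr' (fun j => ?_) ?_
    · skip
      simp [Finsupp.filter_apply]
    · simp
  | cons i l ih =>
    rw [List.nodup_cons] at hl
    rw [List.map_cons, List.prod_cons, Module.End.mul_apply, ih hl.2, pderiv_pow_monomial]
    refine monomial_congr' (fun j => ?_) ?_
    · skip
      by_cases h : j = i
      · subst h; simp [Finsupp.filter_apply, hl.1]
      · simp [Finsupp.filter_apply, h, Finsupp.single_apply, Ne.symm h]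
    · simp [Finsupp.filter_apply, hl.1]
      ring

lemma derivOp_monomial (α β : Fin n →₀ ℕ) (b : k) :
    derivOp α (monomial β b : MvPolynomial (Fin n) k) =
      monomial (β - α) (b * ∏ i, ((β i).descFactorial (α i) : k)) := by
  rw [derivOp, List.ofFn_eq_map, list_deriv_monomial _ _ (List.nodup_finRange n)]
  refine monomial_congr' (fun j => ?_) ?_
  · skip
    simp [Finsupp.filter_apply]
  · rw [← List.ofFn_eq_map, List.prod_ofFn]

lemma taylor {E : Type*} [CommRing E] [Algebra k E] (a y : Fin n → E) (T : Fin n → ℕ)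
    (hy : ∀ i, y i ^ T i = 0) (f : MvPolynomial (Fin n) k) :
    aeval (fun i => a i + y i) f = ∑ α ∈ Fintype.piFinset (fun i => Finset.range (T i)),
      algebraMap k E (∏ i, ((α i).factorial : k))⁻¹ *
        aeval a (derivOp (Finsupp.equivFunOnFinite.symm α) f) * ∏ i, y i ^ α i := by
  induction f using MvPolynomial.induction_on' with
  | add p q hp hq => simp only [map_add, hp, hq, mul_add, add_mul, Finset.sum_add_distrib]
  | monomial β b =>
    simp only [derivOp_monomial, aeval_monomial, Finsupp.prod_fintype _ _ (fun _ => pow_zero _)]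
    have key : ∀ i, (a i + y i) ^ β i = ∑ j ∈ Finset.range (T i),
        algebraMap k E ((β i).descFactorial j * ((j.factorial : k))⁻¹) * a i ^ (β i - j) * y i ^ j := by
      intro i
      have e1 : ∀ j, algebraMap k E ((β i).descFactorial j * ((j.factorial : k))⁻¹) =
          ((β i).choose j : E) := by
        intro j
        rw [Nat.descFactorial_eq_factorial_mul_choose]
        rw [Nat.cast_mul, mul_comm, ← mul_assoc, inv_mul_cancel₀ (by exact_mod_cast Nat.factorial_ne_zero j),
          one_mul, map_natCast]
      simp only [e1]
      rw [add_comm, add_pow]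
      have h1 : ∑ j ∈ Finset.range (β i + 1), y i ^ j * a i ^ (β i - j) * ((β i).choose j : E) =
          ∑ j ∈ Finset.range (β i + 1 + T i), y i ^ j * a i ^ (β i - j) * ((β i).choose j : E) := by
        apply Finset.sum_subset (by simp)
        intro j _ hj
        rw [Nat.choose_eq_zero_of_lt (by simpa using hj)]; simp
      have h2 : ∑ j ∈ Finset.range (T i), y i ^ j * a i ^ (β i - j) * ((β i).choose j : E) =
          ∑ j ∈ Finset.range (β i + 1 + T i), y i ^ j * a i ^ (β i - j) * ((β i).choose j : E) := by
        apply Finset.sum_subset (by simp)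
        intro j _ hj
        rw [pow_eq_zero_of_le (by simpa using hj) (hy i)]; simp
      rw [h1, ← h2]
      exact Finset.sum_congr rfl fun j _ => by ring
    simp only [key]
    rw [Finset.prod_univ_sum, Finset.mul_sum]
    refine Finset.sum_congr rfl fun α _ => ?_
    simp only [Finset.prod_mul_distrib, map_mul, map_prod, map_inv₀, Finsupp.coe_tsub, Pi.sub_apply,
      Finsupp.equivFunOnFinite_symm_apply_apply, ← Finset.prod_inv_distrib]
    ring

end Taylor
section HeightBound

lemma height_le_of_indep {n : ℕ} {k : Type*} [Field k] (p : Ideal (MvPolynomial (Fin n) k))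
    [p.IsPrime] {S₁ S₂ : Type} [Finite S₁] (e : S₁ ⊕ S₂ ≃ Fin n)
    (h : AlgebraicIndependent k (fun i : S₂ => Ideal.Quotient.mk p (X (e (Sum.inr i))))) :
    p.height ≤ (Nat.card S₁ : ℕ∞) := by
  let Q := MvPolynomial S₂ k
  let L := FractionRing Q
  let φ : MvPolynomial S₁ Q ≃ₐ[k] MvPolynomial (Fin n) k :=
    (sumAlgEquiv k S₁ S₂).symm.trans (renameEquiv k e)
  let q : Ideal (MvPolynomial S₁ Q) := p.comap φ.toRingEquiv
  have hq : q.height = p.height := RingEquiv.height_comap φ.toRingEquiv p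
  let _ : Algebra (MvPolynomial S₁ Q) (MvPolynomial S₁ L) := algebraMvPolynomial
  have : IsLocalization ((nonZeroDivisors Q).map (C (σ := S₁))) (MvPolynomial S₁ L) :=
    MvPolynomial.isLocalization _ _
  have : q.IsPrime := Ideal.comap_isPrime _ _
  have hφ : ∀ f : Q, Ideal.Quotient.mk p (φ (C f)) =
      aeval (fun i : S₂ => Ideal.Quotient.mk p (X (e (Sum.inr i)))) f := by
    intro f
    have : ((Ideal.Quotient.mkₐ k p).comp (φ.toAlgHom.comp
      (IsScalarTower.toAlgHom k Q (MvPolynomial S₁ Q)))) =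
      aeval (fun i : S₂ => Ideal.Quotient.mk p (X (e (Sum.inr i)))) := by
      refine MvPolynomial.algHom_ext fun i => ?_
      have h1 : φ (C (X i)) = X (e (Sum.inr i)) := by
        have h2 : (sumAlgEquiv k S₁ S₂).symm (C (X i)) = X (Sum.inr i) := by
          rw [← sumAlgEquiv_X_inr, AlgEquiv.symm_apply_apply]
        simp [φ, h2]
      rw [aeval_X, ← h1]
      rfl
    exact DFunLike.congr_fun this f
  have hd : Disjoint (((nonZeroDivisors Q).map (C (σ := S₁)) : Submonoid _) :
      Set (MvPolynomial S₁ Q)) (q : Set _) := by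
    rw [Set.disjoint_left]
    rintro _ ⟨f, hf, rfl⟩ hfq
    have h1 : φ (C f) ∈ p := hfq
    rw [← Ideal.Quotient.eq_zero_iff_mem, hφ] at h1
    have h2 : f = 0 := (injective_iff_map_eq_zero _).1 h f h1
    exact nonZeroDivisors.ne_zero hf h2
  have hh := IsLocalization.height_map_of_disjoint (S := MvPolynomial S₁ L) _ q hd
  have hp : (q.map (algebraMap (MvPolynomial S₁ Q) (MvPolynomial S₁ L))).IsPrime :=
    IsLocalization.isPrime_of_isPrime_disjoint _ _ q ‹_› hd
  have hk := Ideal.height_le_ringKrullDim_of_isPrime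
    (I := q.map (algebraMap (MvPolynomial S₁ Q) (MvPolynomial S₁ L)))
  rw [hh, hq, MvPolynomial.ringKrullDim_of_isNoetherianRing, ringKrullDim_eq_zero_of_field,
    zero_add] at hk
  exact_mod_cast hk

lemma algebraic_of_height {n c : ℕ} {k : Type*} [Field k] (hc : c ≤ n)
    (p : Ideal (MvPolynomial (Fin n) k)) [p.IsPrime] (hht : p.height = (c : ℕ∞))
    (h : AlgebraicIndependent k
      (fun i : {i : Fin n // c ≤ (i : ℕ)} => Ideal.Quotient.mk p (X i.1)))
    [Algebra (MvPolynomial {i : Fin n // c ≤ (i : ℕ)} k) (MvPolynomial (Fin n) k ⧸ p)]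
    [IsScalarTower k (MvPolynomial {i : Fin n // c ≤ (i : ℕ)} k) (MvPolynomial (Fin n) k ⧸ p)]
    (hX : ∀ i, algebraMap (MvPolynomial {i : Fin n // c ≤ (i : ℕ)} k) (MvPolynomial (Fin n) k ⧸ p)
      (X i) = Ideal.Quotient.mk p (X i.1)) :
    Algebra.IsAlgebraic (MvPolynomial {i : Fin n // c ≤ (i : ℕ)} k)
      (MvPolynomial (Fin n) k ⧸ p) := by
  have hinj : Function.Injective (algebraMap (MvPolynomial {i : Fin n // c ≤ (i : ℕ)} k)
      (MvPolynomial (Fin n) k ⧸ p)) := by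
    have : IsScalarTower.toAlgHom k (MvPolynomial {i : Fin n // c ≤ (i : ℕ)} k)
      (MvPolynomial (Fin n) k ⧸ p) =
        aeval (fun i : {i : Fin n // c ≤ (i : ℕ)} => Ideal.Quotient.mk p (X i.1)) :=
      MvPolynomial.algHom_ext fun i => by simp [hX]
    have h2 : Function.Injective (IsScalarTower.toAlgHom k
      (MvPolynomial {i : Fin n // c ≤ (i : ℕ)} k) (MvPolynomial (Fin n) k ⧸ p)) := by
      rw [this]; exact h
    exact h2
  have hvar : ∀ j : Fin n, IsAlgebraic (MvPolynomial {i : Fin n // c ≤ (i : ℕ)} k)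
      (Ideal.Quotient.mk p (X j)) := by
    intro j
    by_cases hj : c ≤ (j : ℕ)
    · have := hX ⟨j, hj⟩
      rw [← this]
      exact isAlgebraic_algebraMap _
    by_contra htr
    have h1 : AlgebraicIndependent (MvPolynomial {i : Fin n // c ≤ (i : ℕ)} k)
      (fun _ : Unit => Ideal.Quotient.mk p (X j)) :=
        (algebraicIndependent_unique_type_iff).2 htr
    have h2 := AlgebraicIndependent.sumElim_comp (R := k)
      (MvPolynomial.algebraicIndependent_X {i : Fin n // c ≤ (i : ℕ)} k) h1
    classical
    let S₁ := {i : Fin n // ¬ (c ≤ (i : ℕ)) ∧ i ≠ j}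
    let e : S₁ ⊕ (Unit ⊕ {i : Fin n // c ≤ (i : ℕ)}) → Fin n :=
      Sum.elim Subtype.val (Sum.elim (fun _ => j) Subtype.val)
    have he : Function.Bijective e := by
      constructor
      · rintro (⟨a, ha⟩ | _ | ⟨a, ha⟩) (⟨b, hb⟩ | _ | ⟨b, hb⟩) hab <;>
          simp only [e, Sum.elim_inl, Sum.elim_inr] at hab <;> grind
      · intro i
        by_cases h1 : c ≤ (i : ℕ)
        · exact ⟨Sum.inr (Sum.inr ⟨i, h1⟩), rfl⟩
        · by_cases h2 : i = j
          · exact ⟨Sum.inr (Sum.inl ()), h2.symm⟩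
          · exact ⟨Sum.inl ⟨i, h1, h2⟩, rfl⟩
    have h3 := height_le_of_indep p (Equiv.ofBijective e he) (by
      convert h2 using 1
      funext i
      rcases i with _ | i
      · rfl
      · simp [hX, e])
    rw [hht] at h3
    have h4 : Nat.card S₁ < c := by
      have : Nat.card S₁ < Nat.card {i : Fin n // ¬ (c ≤ (i : ℕ))} := by
        rw [Nat.card_eq_fintype_card, Nat.card_eq_fintype_card]
        refine Fintype.card_lt_of_injective_of_notMem (fun i : S₁ => ⟨i.1, i.2.1⟩)
          (fun a b hab => Subtype.ext (by simpa using hab)) (b := ⟨j, hj⟩) ?_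
        rintro ⟨a, ha⟩
        exact a.2.2 (by simpa using ha)
      have h5 : Nat.card {i : Fin n // ¬ (c ≤ (i : ℕ))} ≤ c := by
        have := Nat.card_le_card_of_injective
          (fun i : {i : Fin n // ¬ (c ≤ (i : ℕ))} => (⟨i.1.1, by have := i.2; omega⟩ : Fin c))
          (fun a b hab => Subtype.ext (Fin.ext (by simpa using hab)))
        simpa using this
      omega
    exact absurd (by exact_mod_cast h3) (not_le.2 h4)
  constructor
  intro x
  obtain ⟨f, rfl⟩ := Ideal.Quotient.mk_surjective x
  induction f using MvPolynomial.induction_on with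
  | C a =>
    have : Ideal.Quotient.mk p (C a) = algebraMap (MvPolynomial {i : Fin n // c ≤ (i : ℕ)} k) _
        (algebraMap k _ a) := by
      rw [← IsScalarTower.algebraMap_apply]; rfl
    rw [this]
    exact isAlgebraic_algebraMap _
  | add f g hf hg => rw [map_add]; exact hf.add hg
  | mul_X f i hf => rw [map_mul]; exact hf.mul (hvar i)

end HeightBound
section LocalAlg

open IsLocalRing

lemma exists_pow_le_annihilator {A N : Type*} [CommRing A] [IsLocalRing A] [AddCommGroup N]
    [Module A N] (h : IsFiniteLength A N) :
    ∃ t : ℕ, maximalIdeal A ^ t ≤ Module.annihilator A N := by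
  obtain ⟨_, _⟩ := isFiniteLength_iff_isNoetherian_isArtinian.1 h
  obtain ⟨t, ht⟩ := IsArtinian.monotone_stabilizes
    (⟨fun s => OrderDual.toDual ((maximalIdeal A ^ s) • (⊤ : Submodule A N)), fun a b hab =>
      OrderDual.toDual_le_toDual.2 (Submodule.smul_mono_left (Ideal.pow_le_pow_right hab))⟩ :
      ℕ →o (Submodule A N)ᵒᵈ)
  have h1 : (maximalIdeal A ^ t) • (⊤ : Submodule A N) =
    (maximalIdeal A ^ (t + 1)) • (⊤ : Submodule A N) := ht (t + 1) (Nat.le_succ t)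
  have h2 : (maximalIdeal A ^ t) • (⊤ : Submodule A N) = ⊥ := by
    refine Submodule.eq_bot_of_le_smul_of_le_jacobson_bot (maximalIdeal A) _
      (IsNoetherian.noetherian _) ?_ (IsLocalRing.maximalIdeal_le_jacobson _)
    rw [← mul_smul, ← pow_succ']
    exact h1.le
  refine ⟨t, fun a ha => Module.mem_annihilator.2 fun v => ?_⟩
  have : a • v ∈ (maximalIdeal A ^ t) • (⊤ : Submodule A N) :=
    Submodule.smul_mem_smul ha trivial
  rwa [h2] at this

lemma exists_section {P A : Type*} [CommRing P] [CommRing A] [IsLocalRing A] [Algebra P A]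
    [Algebra.FormallySmooth P (ResidueField A)] (I : Ideal A) (hI : I ≤ maximalIdeal A) {t : ℕ}
    (ht : maximalIdeal A ^ t ≤ I) :
    ∃ σ : ResidueField A →ₐ[P] A ⧸ I, ∀ a : A,
      (Ideal.Quotient.mk I a - σ (residue A a)) ∈ (maximalIdeal A).map (Ideal.Quotient.mk I) := by
  let g : A ⧸ I →ₐ[P] ResidueField A := Ideal.Quotient.liftₐ I
    (IsScalarTower.toAlgHom P A (ResidueField A)) (fun a ha => by
      have := hI ha
      simpa [ResidueField.algebraMap_eq, residue_eq_zero_iff] using this)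
  have hg : ∀ a, g (Ideal.Quotient.mk I a) = residue A a := fun a => rfl
  have hsurj : Function.Surjective g := fun z => by
    obtain ⟨a, rfl⟩ := residue_surjective z
    exact ⟨Ideal.Quotient.mk I a, hg a⟩
  have hker : ∀ z, g z = 0 → z ∈ (maximalIdeal A).map (Ideal.Quotient.mk I) := by
    intro z hz
    obtain ⟨a, rfl⟩ := Ideal.Quotient.mk_surjective z
    rw [hg, residue_eq_zero_iff] at hz
    exact Ideal.mem_map_of_mem _ hz
  have hnil : IsNilpotent (RingHom.ker (g : A ⧸ I →+* ResidueField A)) := by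
    refine ⟨t, ?_⟩
    rw [Ideal.zero_eq_bot, eq_bot_iff]
    refine (Ideal.pow_right_mono (J := (maximalIdeal A).map (Ideal.Quotient.mk I)) ?_ t).trans ?_
    · intro z hz
      exact hker z hz
    · rw [← Ideal.map_pow, Ideal.map_le_iff_le_comap]
      intro a ha
      simpa using Ideal.Quotient.eq_zero_iff_mem.2 (ht ha)
  refine ⟨Algebra.FormallySmooth.liftOfSurjective (AlgHom.id P _) g hsurj hnil, fun a => hker _ ?_⟩
  rw [map_sub, hg, sub_eq_zero]
  exact (Algebra.FormallySmooth.liftOfSurjective_apply (AlgHom.id P _) g hsurj hnil _).symm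

lemma exists_basis_of_section {F E N : Type*} [Field F] [CommRing E] [IsLocalRing E] [Algebra F E]
    (hs : Function.Surjective ((residue E).comp (algebraMap F E)))
    [AddCommGroup N] [Module E N] [Module F N] [IsScalarTower F E N] {m : ℕ}
    (hm : Module.length E N = m) : Nonempty (Module.Basis (Fin m) F N) := by
  have hloc : IsLocalHom (algebraMap F E) := inferInstance
  have h1 := IsLocalRing.length_restrictScalars F E N
  have h2 : Module.length (ResidueField F) (ResidueField E) = 1 := by
    rw [Module.length_eq_of_surjective (S := ResidueField F) (R := ResidueField E)]
    · exact Module.length_eq_one _ _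
    · intro z
      obtain ⟨a, ha⟩ := hs z
      exact ⟨residue F a, ha⟩
  rw [h2, mul_one, hm] at h1
  have hfin : Module.Finite F N := by
    have : IsFiniteLength F N := Module.length_ne_top_iff.1 (by rw [h1]; simp)
    have := (isFiniteLength_iff_isNoetherian_isArtinian.1 this).1
    infer_instance
  rw [Module.length_eq_finrank] at h1
  have h3 : Module.finrank F N = m := by exact_mod_cast h1
  exact ⟨Module.finBasisOfFinrankEq F N h3⟩

lemma core {n c r m : ℕ} {k P A N : Type*} [Field k] [CharZero k] [CommRing P] [CommRing A]
    [IsLocalRing A] [Algebra P A] [Algebra k P] [Algebra k A] [IsScalarTower k P A]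
    [Algebra.FormallySmooth P (ResidueField A)]
    [AddCommGroup N] [Module A N] [Nontrivial N] (hm : Module.length A N = m)
    (x : Fin n → A) (hx : ∀ i : Fin n, c ≤ (i : ℕ) → ∃ z : P, algebraMap P A z = x i) :
    ∃ (T : Fin n → ℕ) (Φ : Fin m → (Fin n → ℕ) → N → ResidueField A),
      (∀ i : Fin n, c ≤ (i : ℕ) → T i = 1) ∧
      ∀ (e : Fin r → N) (w : Fin r → MvPolynomial (Fin n) k),
        ∑ j, (aeval x (w j) : A) • e j = 0 ↔
        ∀ i, ∑ j, ∑ α ∈ Fintype.piFinset (fun i => Finset.range (T i)),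
          residue A (aeval x (derivOp (Finsupp.equivFunOnFinite.symm α) (w j))) * Φ i α (e j) = 0 := by
  classical
  have hfl : IsFiniteLength A N := Module.length_ne_top_iff.1 (by rw [hm]; simp)
  obtain ⟨t, ht⟩ := exists_pow_le_annihilator hfl
  set I := Module.annihilator A N with hIdef
  have hItop : I ≠ ⊤ := by
    intro h
    have : Subsingleton N := Module.annihilator_eq_top_iff.1 h
    exact not_subsingleton N this
  have hI : I ≤ maximalIdeal A := le_maximalIdeal hItop
  obtain ⟨σ, hσ⟩ := exists_section (P := P) I hI ht
  have : Nontrivial (A ⧸ I) := Ideal.Quotient.nontrivial_iff.2 hItop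
  have : IsLocalRing (A ⧸ I) := IsLocalRing.of_surjective' _ Ideal.Quotient.mk_surjective
  let _ : Module (A ⧸ I) N := Module.quotientAnnihilator
  have htow : IsScalarTower A (A ⧸ I) N := ⟨fun a b v => by
    obtain ⟨b, rfl⟩ := Ideal.Quotient.mk_surjective b
    exact mul_smul a b v⟩
  have hmk : ∀ (a : A) (v : N), (Ideal.Quotient.mk I a) • v = a • v := fun a v => rfl
  have hm' : Module.length (A ⧸ I) N = m := by
    rw [← Module.length_eq_of_surjective (S := A) (R := A ⧸ I) Ideal.Quotient.mk_surjective, hm]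
  let _ : Algebra (ResidueField A) (A ⧸ I) := σ.toRingHom.toAlgebra
  let _ : Module (ResidueField A) N := Module.compHom N σ.toRingHom
  have hsmul : ∀ (f : ResidueField A) (v : N), f • v = σ f • v := fun f v => rfl
  have : IsScalarTower (ResidueField A) (A ⧸ I) N := ⟨fun a b v => mul_smul (σ a) b v⟩
  have hnil : ∀ z ∈ (maximalIdeal A).map (Ideal.Quotient.mk I), z ^ t = 0 := by
    intro z hz
    have := Ideal.pow_mem_pow hz t
    rw [← Ideal.map_pow] at this
    have h2 : (maximalIdeal A ^ t).map (Ideal.Quotient.mk I) ≤ ⊥ := by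
      rw [Ideal.map_le_iff_le_comap]
      intro a ha
      simpa using Ideal.Quotient.eq_zero_iff_mem.2 (ht ha)
    simpa using h2 this
  have hmax : (maximalIdeal A).map (Ideal.Quotient.mk I) ≤ maximalIdeal (A ⧸ I) := by
    intro z hz
    rw [mem_maximalIdeal, mem_nonunits_iff]
    intro hu
    have := hu.pow t
    rw [hnil z hz] at this
    exact not_isUnit_zero this
  obtain ⟨b⟩ := exists_basis_of_section (F := ResidueField A) (E := A ⧸ I) (N := N) (by
    intro z
    obtain ⟨z, rfl⟩ := residue_surjective z
    obtain ⟨a, rfl⟩ := Ideal.Quotient.mk_surjective z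
    refine ⟨residue A a, ?_⟩
    have := hmax (hσ a)
    rw [← residue_eq_zero_iff, map_sub, sub_eq_zero] at this
    exact this.symm) hm'
  let y : Fin n → A ⧸ I := fun i => Ideal.Quotient.mk I (x i) - σ (residue A (x i))
  let T : Fin n → ℕ := fun i => if c ≤ (i : ℕ) then 1 else t
  have hy : ∀ i, y i ^ T i = 0 := by
    intro i
    by_cases hi : c ≤ (i : ℕ)
    · obtain ⟨z, hz⟩ := hx i hi
      have h1 : σ (residue A (x i)) = Ideal.Quotient.mk I (x i) := by
        rw [← hz]
        exact σ.commutes z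
      simp [T, hi, y, h1]
    · simp only [T, hi, if_false]
      exact hnil _ (hσ _)
  have haev : ∀ g : MvPolynomial (Fin n) k,
      aeval (fun i => σ (residue A (x i))) g = σ (residue A (aeval x g)) := by
    intro g
    induction g using MvPolynomial.induction_on with
    | C a =>
      rw [← algebraMap_eq, AlgHom.commutes, AlgHom.commutes, IsScalarTower.algebraMap_apply k P A]
      have := σ.commutes (algebraMap k P a)
      refine Eq.trans ?_ this.symm
      rw [IsScalarTower.algebraMap_apply k A (A ⧸ I), IsScalarTower.algebraMap_apply P A (A ⧸ I),
        IsScalarTower.algebraMap_apply k P A]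
    | add f g hf hg => simp only [map_add, hf, hg]
    | mul_X f i hf => simp only [map_mul, hf, aeval_X]
  refine ⟨T, fun i α v => b.repr ((algebraMap k (A ⧸ I) (∏ i, ((α i).factorial : k))⁻¹ *
    ∏ i, y i ^ α i) • v) i, fun i hi => by simp [T, hi], fun e w => ?_⟩
  have hexp : ∀ f : MvPolynomial (Fin n) k, ∀ v : N, (aeval x f : A) • v =
      ∑ α ∈ Fintype.piFinset (fun i => Finset.range (T i)),
        residue A (aeval x (derivOp (Finsupp.equivFunOnFinite.symm α) f)) •
          ((algebraMap k (A ⧸ I) (∏ i, ((α i).factorial : k))⁻¹ * ∏ i, y i ^ α i) • v) := by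
    intro f v
    have h1 : Ideal.Quotient.mk I (aeval x f) = aeval (fun i => σ (residue A (x i)) + y i) f := by
      have h2 : (fun i => σ (residue A (x i)) + y i) = fun i => Ideal.Quotient.mk I (x i) := by
        funext i; simp [y]
      rw [h2]
      exact (MvPolynomial.comp_aeval_apply x (Ideal.Quotient.mkₐ k I) f)
    rw [← hmk, h1, taylor _ _ _ hy, Finset.sum_smul]
    refine Finset.sum_congr rfl fun α _ => ?_
    rw [hsmul, ← mul_smul, haev]
    congr 1
    ring
  have hsum : ∑ j, (aeval x (w j) : A) • e j = 0 ↔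
      ∀ i, b.repr (∑ j, (aeval x (w j) : A) • e j) i = 0 := by
    rw [← b.repr.map_eq_zero_iff]
    exact DFunLike.ext_iff
  rw [hsum]
  refine forall_congr' fun i => ?_
  simp only [hexp, map_sum, map_smul, Finsupp.coe_finset_sum, Finset.sum_apply, Finsupp.smul_apply,
    smul_eq_mul]

end LocalAlg
section Assembly

lemma formallySmooth_residue {n c : ℕ} {k : Type*} [Field k] [CharZero k] (hc : c ≤ n)
    (p : Ideal (MvPolynomial (Fin n) k)) [p.IsPrime] (hht : p.height = (c : ℕ∞))
    (h : AlgebraicIndependent k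
      (fun i : {i : Fin n // c ≤ (i : ℕ)} => Ideal.Quotient.mk p (X i.1)))
    [Algebra (MvPolynomial {i : Fin n // c ≤ (i : ℕ)} k) (MvPolynomial (Fin n) k)]
    [IsScalarTower k (MvPolynomial {i : Fin n // c ≤ (i : ℕ)} k) (MvPolynomial (Fin n) k)]
    (hX : ∀ i, algebraMap (MvPolynomial {i : Fin n // c ≤ (i : ℕ)} k) (MvPolynomial (Fin n) k)
      (X i) = X i.1) :
    Algebra.FormallySmooth (MvPolynomial {i : Fin n // c ≤ (i : ℕ)} k)
      (IsLocalRing.ResidueField (Localization.AtPrime p)) := by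
  let P := MvPolynomial {i : Fin n // c ≤ (i : ℕ)} k
  let R := MvPolynomial (Fin n) k
  have hX' : ∀ i, algebraMap P (R ⧸ p) (X i) = Ideal.Quotient.mk p (X i.1) := fun i => by
    rw [IsScalarTower.algebraMap_apply P R (R ⧸ p), hX]; rfl
  have t1 : IsScalarTower k P (R ⧸ p) := IsScalarTower.of_algebraMap_eq
    (R := k) (S := P) (A := R ⧸ p) fun a => by
    rw [IsScalarTower.algebraMap_apply P R (R ⧸ p), ← IsScalarTower.algebraMap_apply k P R]
    rfl
  have halg : Algebra.IsAlgebraic P (R ⧸ p) := algebraic_of_height hc p hht h hX'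
  have hinj : Function.Injective (algebraMap P (R ⧸ p)) := by
    have : IsScalarTower.toAlgHom k P (R ⧸ p) =
        aeval (fun i : {i : Fin n // c ≤ (i : ℕ)} => Ideal.Quotient.mk p (X i.1)) :=
      MvPolynomial.algHom_ext fun i => by
        rw [aeval_X, ← hX']; rfl
    have h2 : Function.Injective (IsScalarTower.toAlgHom k P (R ⧸ p)) := by
      rw [this]; exact h
    exact h2
  let F := p.ResidueField
  have t2 : IsScalarTower P (R ⧸ p) F := IsScalarTower.of_algebraMap_eq (R := P) (S := R ⧸ p) (A := F) fun a => by
    rw [IsScalarTower.algebraMap_apply P R (R ⧸ p), IsScalarTower.algebraMap_apply P R F]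
    rfl
  have hinjF : Function.Injective (algebraMap P F) := by
    rw [IsScalarTower.algebraMap_eq P (R ⧸ p) F]
    exact (IsFractionRing.injective (R ⧸ p) F).comp hinj
  have : FaithfulSMul P F := (faithfulSMul_iff_algebraMap_injective P F).2 hinjF
  have halg2 : Algebra.IsAlgebraic (R ⧸ p) F := IsLocalization.isAlgebraic _ (nonZeroDivisors (R ⧸ p))
  have halgF : Algebra.IsAlgebraic P F := Algebra.IsAlgebraic.trans P (R ⧸ p) F
  let L := FractionRing P
  let _ : Algebra L F := FractionRing.liftAlgebra P F
  have t3 : IsScalarTower P L F := FractionRing.isScalarTower_liftAlgebra P F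
  have halgL : Algebra.IsAlgebraic L F := (IsFractionRing.comap_isAlgebraic_iff (A := P)).1 halgF
  have : CharZero L := by
    have hP : CharZero P := inferInstanceAs (CharZero (MvPolynomial _ k))
    exact charZero_of_injective_algebraMap (IsFractionRing.injective P L)
  have hsep : Algebra.IsSeparable L F := inferInstance
  have s1 : Algebra.FormallySmooth P L := Algebra.FormallySmooth.of_isLocalization (nonZeroDivisors P)
  have : Algebra.FormallyEtale L F := Algebra.FormallyEtale.of_isSeparable L F
  exact Algebra.FormallySmooth.comp P L F

lemma act_sum {n r : ℕ} {k : Type*} [Field k] (S : Finset (Fin n → ℕ))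
    (C : Fin r → (Fin n → ℕ) → MvPolynomial (Fin n) k) (w : Fin r → MvPolynomial (Fin n) k) :
    DiffOp.act (fun j => ∑ α ∈ S, Finsupp.single (Finsupp.equivFunOnFinite.symm α) (C j α)) w =
      ∑ j, ∑ α ∈ S, C j α * derivOp (Finsupp.equivFunOnFinite.symm α) (w j) := by
  rw [DiffOp.act, LinearMap.sum_apply]
  refine Finset.sum_congr rfl fun j _ => ?_
  rw [← Finsupp.sum_finsetSum_index (fun _ => by simp) (fun _ _ _ => by rw [add_smul]),
    LinearMap.sum_apply]
  refine Finset.sum_congr rfl fun α _ => ?_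
  rw [Finsupp.sum_single_index (by simp)]
  rfl

lemma main_ops {n c r m : ℕ} {k : Type*} [Field k] [CharZero k] (hc : c ≤ n)
    (p : Ideal (MvPolynomial (Fin n) k)) [p.IsPrime] (hht : p.height = (c : ℕ∞))
    (h : AlgebraicIndependent k
      (fun i : {i : Fin n // c ≤ (i : ℕ)} => Ideal.Quotient.mk p (X i.1)))
    (V : Submodule (MvPolynomial (Fin n) k) (Fin r → MvPolynomial (Fin n) k))
    (hV : IsPrimarySubmodule p V) (hmult : multOver p V = (m : WithBot ℕ∞)) :
    ∃ δ : Fin m → DiffOp n k r, (∀ i, (δ i).InRelWeyl c) ∧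
      (V : Set (Fin r → MvPolynomial (Fin n) k)) = {w | ∀ i : Fin m, (δ i).act w ∈ p} := by
  classical
  let P := MvPolynomial {i : Fin n // c ≤ (i : ℕ)} k
  let R := MvPolynomial (Fin n) k
  let A := Localization.AtPrime p
  let Q := (Fin r → R) ⧸ V
  let N := LocalizedModule p.primeCompl Q
  let ℓ : Q →ₗ[R] N := LocalizedModule.mkLinearMap p.primeCompl Q
  let _ : Algebra P R := (rename (R := k) (Subtype.val : {i : Fin n // c ≤ (i : ℕ)} → Fin n)).toRingHom.toAlgebra
  have t0 : IsScalarTower k P R := IsScalarTower.of_algebraMap_eq fun a =>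
    ((rename (R := k) (Subtype.val : {i : Fin n // c ≤ (i : ℕ)} → Fin n)).commutes a).symm
  have hX : ∀ i, algebraMap P R (X i) = X i.1 := fun i => rename_X _ _
  have hfs := formallySmooth_residue hc p hht h hX
  -- injectivity of the localization map
  have hinj : Function.Injective ℓ := by
    rw [injective_iff_map_eq_zero]
    intro v hv
    obtain ⟨s, hs⟩ := (IsLocalizedModule.eq_zero_iff p.primeCompl ℓ).1 hv
    by_contra hv0
    have h1 : (s : R) ∈ ⋃ q ∈ associatedPrimes R Q, (q : Set R) := by
      rw [biUnion_associatedPrimes_eq_zero_divisors]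
      exact ⟨v, hv0, hs⟩
    have hV' : associatedPrimes R Q = {p} := hV
    rw [hV'] at h1
    simp only [Set.mem_singleton_iff, Set.iUnion_iUnion_eq_left, SetLike.mem_coe] at h1
    exact s.2 h1
  have hQ : Nontrivial Q := by
    by_contra hn
    have := not_nontrivial_iff_subsingleton.1 hn
    have h1 : associatedPrimes R Q = {p} := hV
    rw [associatedPrimes.eq_empty_of_subsingleton] at h1
    exact Set.singleton_ne_empty p h1.symm
  have hN : Nontrivial N := hinj.nontrivial
  have hm : Module.length A N = m := by
    have : (Module.length A N : WithBot ℕ∞) = (m : WithBot ℕ∞) := by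
      rw [Module.coe_length]; exact hmult
    exact_mod_cast this
  have t1 : IsScalarTower k P A := IsScalarTower.of_algebraMap_eq fun a => by
    rw [IsScalarTower.algebraMap_apply P R A, ← IsScalarTower.algebraMap_apply k P R,
      ← IsScalarTower.algebraMap_apply k R A]
  obtain ⟨T, Φ, hT, hΦ⟩ := core (r := r) (k := k) (P := P) (A := A) (N := N) (c := c) hm
    (fun i => algebraMap R A (X i)) (fun i hi => ⟨X ⟨i, hi⟩, by
      rw [IsScalarTower.algebraMap_apply P R A, hX]⟩)
  have haev : ∀ f : R, aeval (fun i => algebraMap R A (X i)) f = algebraMap R A f := fun f =>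
    DFunLike.congr_fun (MvPolynomial.aeval_unique (IsScalarTower.toAlgHom k R A)).symm f
  simp only [haev] at hΦ
  let e : Fin r → N := fun j => ℓ (V.mkQ (Pi.single j 1))
  have hmem : ∀ w : Fin r → R, w ∈ V ↔ ∑ j, algebraMap R A (w j) • e j = 0 := by
    intro w
    have h1 : ∑ j, algebraMap R A (w j) • e j = ℓ (V.mkQ w) := by
      conv_rhs => rw [pi_eq_sum_univ' w]
      rw [map_sum, map_sum]
      refine Finset.sum_congr rfl fun j _ => ?_
      rw [map_smul, map_smul, algebraMap_smul]
    rw [h1, map_eq_zero_iff ℓ hinj]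
    exact (Submodule.Quotient.mk_eq_zero V).symm
  set S := Fintype.piFinset (fun i => Finset.range (T i)) with hS
  choose a ha using fun (i : Fin m) (α : Fin n → ℕ) (j : Fin r) =>
    IsLocalRing.residue_surjective (Φ i α (e j))
  obtain ⟨d, hd⟩ := IsLocalization.exist_integer_multiples p.primeCompl
    ((Finset.univ : Finset (Fin m)) ×ˢ (S ×ˢ (Finset.univ : Finset (Fin r))))
    (fun z => a z.1 z.2.1 z.2.2)
  have hd' : ∀ (i : Fin m) (j : Fin r) (α : Fin n → ℕ), ∃ z : R, α ∈ S →
      algebraMap R A z = algebraMap R A d * a i α j := by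
    intro i j α
    by_cases hα : α ∈ S
    · obtain ⟨z, hz⟩ := hd (i, α, j) (by simp [hα])
      refine ⟨z, fun _ => hz.trans ?_⟩
      rw [Algebra.smul_def]
    · exact ⟨0, fun h => absurd h hα⟩
  choose C hC using hd'
  refine ⟨fun i j => ∑ α ∈ S, Finsupp.single (Finsupp.equivFunOnFinite.symm α) (C i j α), ?_, ?_⟩
  · intro i j α hα l hl
    have h1 := Finsupp.support_finsetSum hα
    simp only [Finset.mem_biUnion] at h1
    obtain ⟨β, hβ, hβ'⟩ := h1
    have h2 := Finset.mem_singleton.1 (Finsupp.support_single_subset hβ')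
    have h3 := Fintype.mem_piFinset.1 hβ l
    rw [hT l hl] at h3
    rw [h2]
    simpa using h3
  · ext w
    rw [SetLike.mem_coe, hmem, hΦ e w, Set.mem_setOf_eq]
    refine forall_congr' fun i => ?_
    rw [act_sum, ← IsLocalization.AtPrime.to_map_mem_maximal_iff A p,
      ← IsLocalRing.residue_eq_zero_iff]
    have h1 : IsLocalRing.residue A (algebraMap R A (∑ j, ∑ α ∈ S,
        C i j α * derivOp (Finsupp.equivFunOnFinite.symm α) (w j))) =
        IsLocalRing.residue A (algebraMap R A d) * ∑ j, ∑ α ∈ S, IsLocalRing.residue A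
          (algebraMap R A (derivOp (Finsupp.equivFunOnFinite.symm α) (w j))) * Φ i α (e j) := by
      simp only [map_sum, Finset.mul_sum]
      refine Finset.sum_congr rfl fun j _ => Finset.sum_congr rfl fun α hα => ?_
      rw [map_mul, hC i j α hα, map_mul, map_mul, ha]
      ring
    rw [h1, mul_eq_zero, or_iff_right]
    rw [IsLocalRing.residue_eq_zero_iff, IsLocalization.AtPrime.to_map_mem_maximal_iff A p]
    exact d.2

lemma lift_equiv {R W : Type*} [CommRing R] [AddCommGroup W] [Module R W] (K : Submodule R W)
    (U : Submodule R (W ⧸ K)) : Nonempty ((W ⧸ U.comap K.mkQ) ≃ₗ[R] ((W ⧸ K) ⧸ U)) := by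
  have hk : LinearMap.ker (U.mkQ ∘ₗ K.mkQ) = U.comap K.mkQ := by
    rw [LinearMap.ker_comp, Submodule.ker_mkQ]
  exact ⟨(Submodule.quotEquivOfEq _ _ hk.symm).trans
    ((U.mkQ ∘ₗ K.mkQ).quotKerEquivOfSurjective
      ((Submodule.mkQ_surjective _).comp (Submodule.mkQ_surjective _)))⟩

lemma multOver_congr {R M M' : Type*} [CommRing R] [AddCommGroup M] [Module R M]
    [AddCommGroup M'] [Module R M'] (p : Ideal R) [p.IsPrime] (U : Submodule R M)
    (U' : Submodule R M') (e : (M ⧸ U) ≃ₗ[R] (M' ⧸ U')) : multOver p U = multOver p U' := by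
  have e' : LocalizedModule p.primeCompl (M ⧸ U) ≃ₗ[Localization.AtPrime p]
      LocalizedModule p.primeCompl (M' ⧸ U') :=
    IsLocalizedModule.mapEquiv p.primeCompl (LocalizedModule.mkLinearMap p.primeCompl _)
      (LocalizedModule.mkLinearMap p.primeCompl _) (Localization.AtPrime p) e
  exact Order.krullDim_eq_of_orderIso (Submodule.orderIsoMapComap e')

end Assembly

/-- for `K ⊆ R^r`, `M = R^r/K` with projection `π`, and a `p`-primary
submodule `U ⊆ M` of multiplicity `m` over `p`, the lift `Ũ = π^{-1}(U) ⊆ R^r` is a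
`p`-primary submodule of multiplicity `m` over `p`, and there exist `m` differential
operators `δ_1,…,δ_m ∈ D_{n,c}^r` with `Ũ = {w ∈ R^r | δ_i(w) ∈ p for all i}`. -/
theorem stmt8 (n c r m : ℕ) (k : Type*) [Field k] [CharZero k] (hc : c ≤ n) (hr : 1 ≤ r)
    (p : Ideal (MvPolynomial (Fin n) k)) [p.IsPrime]
    (hht : Order.height (⟨p, inferInstance⟩ : PrimeSpectrum (MvPolynomial (Fin n) k)) =
      (c : ℕ∞))
    (hbasis : AlgebraicIndependent k
      (fun i : {i : Fin n // c ≤ (i : ℕ)} => Ideal.Quotient.mk p (X i.1)))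
    (K : Submodule (MvPolynomial (Fin n) k) (Fin r → MvPolynomial (Fin n) k))
    (U : Submodule (MvPolynomial (Fin n) k) ((Fin r → MvPolynomial (Fin n) k) ⧸ K))
    (hU : IsPrimarySubmodule p U) (hmult : multOver p U = (m : WithBot ℕ∞)) :
    IsPrimarySubmodule p (U.comap K.mkQ) ∧
    multOver p (U.comap K.mkQ) = (m : WithBot ℕ∞) ∧
    ∃ δ : Fin m → DiffOp n k r, (∀ i, (δ i).InRelWeyl c) ∧
      ((U.comap K.mkQ : Submodule (MvPolynomial (Fin n) k)
          (Fin r → MvPolynomial (Fin n) k)) : Set (Fin r → MvPolynomial (Fin n) k)) =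
        {w | ∀ i : Fin m, (δ i).act w ∈ p} := by
  obtain ⟨e⟩ := lift_equiv K U
  have h1 : IsPrimarySubmodule p (U.comap K.mkQ) := (LinearEquiv.AssociatedPrimes.eq e).trans hU
  have h2 : multOver p (U.comap K.mkQ) = (m : WithBot ℕ∞) := (multOver_congr p _ _ e).trans hmult
  have hht' : p.height = (c : ℕ∞) :=
    (PrimeSpectrum.height_eq_orderHeight (⟨p, inferInstance⟩ : PrimeSpectrum _)).trans hht
  exact ⟨h1, h2, main_ops hc p hht' hbasis _ h1 h2⟩
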